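/- arXiv:2402.17153 — 2 statements merged into one kernel-verified Lean document; each statement's English description precedes it below -/
import Mathlib

section
/- Let d ≥ 1, fix an index a, fix τ ∈ ℝ, and let λ_{b,c}(τ), μ_b(τ), γ_{b,c}(τ), ψ_b(τ) be real numbers with γ_{a,a}(τ) = 0. Let E : ℝ → (Fin d → ℝ) and g : ℝ → ℝ be functions with E_a(τ) ≠ 1 and E_b(τ) ≠ 1 for all b. Suppose that at τ the component E_a has derivative ∑_b λ_{a,b}(τ)(E_a(τ)E_b(τ) − E_a(τ)) + μ_a(τ)(1 − E_a(τ)) − ψ_a(τ)E_a(τ) + ∑_b γ_{a,b}(τ)(E_b(τ) − E_a(τ)), and that g has derivative at τ equal to [λ_{a,a}(τ)(2E_a(τ) − 1) + ∑_{b≠a} λ_{a,b}(τ)(E_b(τ) − 1) − μ_a(τ) − ψ_a(τ) − ∑_{b≠a} γ_{a,b}(τ)] · g(τ). Then the function τ ↦ g(τ)/(1 − E_a(τ)) has derivative at τ equal to [−∑_b (1 − E_b(τ))λ_{a,b}(τ) − ψ_a(τ)/(1 − E_a(τ)) − ∑_{b≠a} ((1 − E_b(τ))/(1 − E_a(τ)))(γ_{a,b}(τ)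 + E_a(τ)λ_{a,b}(τ))] · g(τ)/(1 − E_a(τ)). -/
open Finset

/-- ODE agreement for the conditional density `g/(1 - E_a)` in the proof of
forward equivalence for BDMS models. -/
theorem bdms_conditional_density_ode
    (d : ℕ) (hd : 1 ≤ d) (a : Fin d) (τ : ℝ)
    (lam : Fin d → Fin d → ℝ) (mu psi : Fin d → ℝ) (gam : Fin d → Fin d → ℝ)
    (hgam : gam a a = 0)
    (E : ℝ → Fin d → ℝ) (g : ℝ → ℝ)
    (hEa : E τ a ≠ 1) (hEb : ∀ b, E τ b ≠ 1)
    (hE : HasDerivAt (fun t => E t a)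
      (∑ b, lam a b * (E τ a * E τ b - E τ a) + mu a * (1 - E τ a)
        - psi a * E τ a + ∑ b, gam a b * (E τ b - E τ a)) τ)
    (hg : HasDerivAt g
      ((lam a a * (2 * E τ a - 1)
          + ∑ b ∈ Finset.univ.filter (fun b => b ≠ a), lam a b * (E τ b - 1)
          - mu a - psi a
          - ∑ b ∈ Finset.univ.filter (fun b => b ≠ a), gam a b) * g τ) τ) :
    HasDerivAt (fun t => g t / (1 - E t a))
      ((-∑ b, (1 - E τ b) * lam a b - psi a / (1 - E τ a)
          - ∑ b ∈ Finset.univ.filter (fun b => b ≠ a),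
              ((1 - E τ b) / (1 - E τ a)) * (gam a b + E τ a * lam a b))
        * (g τ / (1 - E τ a))) τ := by
  have hne : 1 - E τ a ≠ 0 := sub_ne_zero.mpr (Ne.symm hEa)
  have hsplit : ∀ f : Fin d → ℝ,
      ∑ b, f b = f a + ∑ b ∈ Finset.univ.filter (fun b => b ≠ a), f b := by
    intro f
    rw [Finset.filter_ne' Finset.univ a]
    exact (Finset.add_sum_erase _ f (Finset.mem_univ a)).symm
  have h := hg.div (hE.const_sub 1) hne
  refine h.congr_deriv ?_
  rw [hsplit (fun b => lam a b * (E τ a * E τ b - E τ a)),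
    hsplit (fun b => gam a b * (E τ b - E τ a)),
    hsplit (fun b => (1 - E τ b) * lam a b)]
  have e1 : ∑ b ∈ Finset.univ.filter (fun b => b ≠ a), lam a b * (E τ a * E τ b - E τ a)
      = E τ a * ∑ b ∈ Finset.univ.filter (fun b => b ≠ a), lam a b * (E τ b - 1) := by
    rw [Finset.mul_sum]
    exact Finset.sum_congr rfl fun b _ => by ring
  have e2 : ∑ b ∈ Finset.univ.filter (fun b => b ≠ a), (1 - E τ b) * lam a b
      = - ∑ b ∈ Finset.univ.filter (fun b => b ≠ a), lam a b * (E τ b - 1) := by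
    rw [← Finset.sum_neg_distrib]
    exact Finset.sum_congr rfl fun b _ => by ring
  have e3 : ∑ b ∈ Finset.univ.filter (fun b => b ≠ a), gam a b * (E τ b - E τ a)
      = ∑ b ∈ Finset.univ.filter (fun b => b ≠ a), gam a b * (E τ b - 1)
        + (1 - E τ a) * ∑ b ∈ Finset.univ.filter (fun b => b ≠ a), gam a b := by
    rw [Finset.mul_sum, ← Finset.sum_add_distrib]
    exact Finset.sum_congr rfl fun b _ => by ring
  have e4 : ∑ b ∈ Finset.univ.filter (fun b => b ≠ a),
        ((1 - E τ b) / (1 - E τ a)) * (gam a b + E τ a * lam a b)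
      = -((∑ b ∈ Finset.univ.filter (fun b => b ≠ a), gam a b * (E τ b - 1)
        + E τ a * ∑ b ∈ Finset.univ.filter (fun b => b ≠ a), lam a b * (E τ b - 1))
          / (1 - E τ a)) := by
    rw [Finset.mul_sum, ← Finset.sum_add_distrib, Finset.sum_div, ← Finset.sum_neg_distrib]
    exact Finset.sum_congr rfl fun b _ => by ring
  rw [e1, e2, e3, e4, hgam]
  generalize ∑ b ∈ Finset.univ.filter (fun b => b ≠ a), lam a b * (E τ b - 1) = S
  generalize ∑ b ∈ Finset.univ.filter (fun b => b ≠ a), gam a b * (E τ b - 1) = T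
  generalize ∑ b ∈ Finset.univ.filter (fun b => b ≠ a), gam a b = U
  field_simp
  ring
end

section
/- Let λ, μ ∈ ℝ with λ ≠ μ, let ρ ∈ (0, 1], and let l, d : ℝ → ℝ satisfy l(0) = 1, d(0) = 0, and for every t ∈ ℝ, l has derivative (λ − μ)·l(t) at t and d has derivative μ + (λ − μ)·d(t) at t. Then (2·l(1) + 2·d(1)) / (2·ρ·l(1)) = (1/ρ)·(1 + μ·(exp(λ − μ) − 1)/((λ − μ)·exp(λ − μ))). -/
theorem bd_exp_aux (r : ℝ) (f : ℝ → ℝ) (hf : ∀ t : ℝ, HasDerivAt f (r * f t) t) :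
    f 1 = f 0 * Real.exp r := by
  have hg : ∀ t : ℝ, HasDerivAt (fun t => f t * Real.exp (-(r * t))) 0 t := by
    intro t
    have h1 : HasDerivAt (fun t : ℝ => -(r * t)) (-(r * 1)) t :=
      ((hasDerivAt_id t).const_mul r).neg
    have h2 := (hf t).mul h1.exp
    refine h2.congr_deriv ?_
    ring
  have h := is_const_of_deriv_eq_zero (fun t => (hg t).differentiableAt)
    (fun t => (hg t).deriv) 1 0
  simp only [mul_one, mul_zero, neg_zero, Real.exp_zero] at h
  rw [← h, mul_assoc, ← Real.exp_add]
  simp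

/-- Case 2 of Proposition 1: the theoretical speedup of the forward-equivalent
simulation for a single-type birth-death process with `λ ≠ μ` run for one unit
of time with extant sampling probability `ρ` is
`(1/ρ)(1 + μ(e^{λ-μ} - 1)/((λ-μ)e^{λ-μ}))`. -/
theorem bd_speedup_noncritical
    (lam mu : ℝ) (hne : lam ≠ mu) (ρ : ℝ) (hρ : ρ ∈ Set.Ioc (0 : ℝ) 1)
    (l d : ℝ → ℝ) (hl0 : l 0 = 1) (hd0 : d 0 = 0)
    (hl : ∀ t : ℝ, HasDerivAt l ((lam - mu) * l t) t)
    (hd : ∀ t : ℝ, HasDerivAt d (mu + (lam - mu) * d t) t) :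
    (2 * l 1 + 2 * d 1) / (2 * ρ * l 1)
      = (1 / ρ) * (1 + mu * (Real.exp (lam - mu) - 1)
          / ((lam - mu) * Real.exp (lam - mu))) := by
  have hr : lam - mu ≠ 0 := sub_ne_zero.mpr hne
  have hρ0 : ρ ≠ 0 := ne_of_gt hρ.1
  have h1 := bd_exp_aux (lam - mu) l hl
  have h2 := bd_exp_aux (lam - mu) (fun t => mu + (lam - mu) * d t)
    (fun t => ((hd t).const_mul (lam - mu)).const_add mu)
  simp only [hd0, mul_zero, add_zero] at h2
  rw [hl0, one_mul] at h1
  have hE : Real.exp (lam - mu) ≠ 0 := Real.exp_ne_zero _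
  have h3 : d 1 = mu * (Real.exp (lam - mu) - 1) / (lam - mu) := by
    rw [eq_div_iff hr]
    linarith
  rw [h1, h3]
  field_simp
end
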